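/- arXiv:2204.05033 — 2 statements merged into one kernel-verified Lean document; each statement's English description precedes it below -/
import Mathlib

section
/- Let Q be an n-type with n = kℓ, ℓ > k ≥ 1, on a finite alphabet A of size m. Then there exists an ℓ-type W on A^k that lies in E_k(Q) (its k one-dimensional marginals average to Q) and satisfies max_{a_1^k ∈ A^k} |W(a_1^k) − Q^k(a_1^k)| ≤ M, where M = [2/ℓ + 4k/ℓ + 2√(k/ℓ)]^{1/2}. -/
open scoped Classical BigOperators

/-- The `j`-th one-dimensional marginal of a distribution `W` on `A^k`. -/
noncomputable def marginal {A : Type*} [Fintype A] (k : ℕ) (W : (Fin k → A) → ℝ)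
    (j : Fin k) (a : A) : ℝ :=
  ∑ y : Fin k → A, if y j = a then W y else 0

/-- The falling factorial compared with the power. -/
lemma desc_bound (n m : ℕ) (hn : 0 < n) :
    1 - (m : ℝ) * (m - 1) / (2 * n) ≤ (n.descFactorial m : ℝ) / (n : ℝ) ^ m := by
  have hn' : (0 : ℝ) < n := by exact_mod_cast hn
  induction m with
  | zero => simp
  | succ m ih =>
    have h1 : (n.descFactorial m : ℝ) / (n : ℝ) ^ m ≤ 1 := by
      rw [div_le_one (by positivity)]
      exact_mod_cast Nat.descFactorial_le_pow n m
    have h0 : 0 ≤ (n.descFactorial m : ℝ) / (n : ℝ) ^ m := by positivity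
    have h2 : (n : ℝ) - m ≤ ((n - m : ℕ) : ℝ) := by
      rw [sub_le_iff_le_add]
      exact_mod_cast (by omega : n ≤ n - m + m)
    have h3 : (n.descFactorial (m + 1) : ℝ) / (n : ℝ) ^ (m + 1)
        = (((n - m : ℕ) : ℝ) / n) * ((n.descFactorial m : ℝ) / (n : ℝ) ^ m) := by
      rw [Nat.descFactorial_succ]
      push_cast
      rw [pow_succ]
      field_simp
    have h4 : 1 - (m : ℝ) / n ≤ ((n - m : ℕ) : ℝ) / n := by
      rw [le_div_iff₀ hn']
      calc (1 - (m : ℝ) / n) * n = n - m := by field_simp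
        _ ≤ _ := h2
    have h5 : (0 : ℝ) ≤ m / n := by positivity
    have h6 : ((m + 1 : ℕ) : ℝ) * ((m + 1 : ℕ) - 1) / (2 * n)
        = (m : ℝ) * (m - 1) / (2 * n) + m / n := by
      push_cast
      field_simp
      ring
    rw [h3, h6]
    have h7 := mul_le_mul_of_nonneg_right h4 h0
    nlinarith

/-- Any two embeddings into a finite type differ by a permutation. -/
lemma exists_perm_emb {I J : Type*} [Fintype I] [Fintype J] (e f : J ↪ I) :
    ∃ σ : Equiv.Perm I, ∀ j, σ (e j) = f j := by
  let g : {x // x ∈ Set.range e} ≃ {x // x ∈ Set.range f} :=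
    (Equiv.ofInjective e e.injective).symm.trans (Equiv.ofInjective f f.injective)
  refine ⟨g.extendSubtype, fun j => ?_⟩
  rw [Equiv.extendSubtype_apply_of_mem g (e j) ⟨j, rfl⟩]
  have : (⟨e j, ⟨j, rfl⟩⟩ : {x // x ∈ Set.range e}) = Equiv.ofInjective e e.injective j := rfl
  rw [this]
  simp [g]

/-- Averaging over permutations is averaging over embeddings. -/
lemma sum_emb_eq {I J : Type*} [Fintype I] [Fintype J] [DecidableEq I] [DecidableEq J] (e : J ↪ I) (F : (J → I) → ℝ) :
    (Fintype.card (Equiv.Perm I) : ℝ) * ∑ f : J ↪ I, F f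
      = (Fintype.card (J ↪ I) : ℝ) * ∑ σ : Equiv.Perm I, F (fun j => σ (e j)) := by
  have h1 : ∀ τ : Equiv.Perm I, ∑ f : J ↪ I, F f = ∑ f : J ↪ I, F (fun j => τ (f j)) := by
    intro τ
    symm
    refine Fintype.sum_equiv (Equiv.embeddingCongr (Equiv.refl J) τ) _ _ ?_
    intro f
    congr 1
  have h2 : ∀ f : J ↪ I, ∑ τ : Equiv.Perm I, F (fun j => τ (f j))
      = ∑ σ : Equiv.Perm I, F (fun j => σ (e j)) := by
    intro f
    obtain ⟨π, hπ⟩ := exists_perm_emb e f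
    refine Fintype.sum_equiv (Equiv.mulRight π) _ _ ?_
    intro τ
    simp [hπ]
  calc (Fintype.card (Equiv.Perm I) : ℝ) * ∑ f : J ↪ I, F f
      = ∑ τ : Equiv.Perm I, ∑ f : J ↪ I, F (fun j => τ (f j)) := by
        rw [← Finset.sum_congr rfl (fun τ _ => h1 τ)]
        simp
    _ = ∑ f : J ↪ I, ∑ τ : Equiv.Perm I, F (fun j => τ (f j)) := Finset.sum_comm
    _ = _ := by
        rw [Finset.sum_congr rfl (fun f _ => h2 f)]
        simp

/-- Sampling without replacement versus with replacement, upper bound. -/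
lemma perm_avg_le {I J : Type*} [Fintype I] [Fintype J] [DecidableEq I] [DecidableEq J] [Nonempty I] (e : J ↪ I)
    (F : (J → I) → ℝ) (h0 : ∀ f, 0 ≤ F f) (h1 : ∀ f, F f ≤ 1) :
    (∑ σ : Equiv.Perm I, F (fun j => σ (e j))) / (Fintype.card (Equiv.Perm I) : ℝ)
      ≤ (∑ f : J → I, F f) / (Fintype.card I : ℝ) ^ Fintype.card J
        + (Fintype.card J : ℝ) * (Fintype.card J - 1) / (2 * Fintype.card I) := by
  set E := (∑ σ : Equiv.Perm I, F (fun j => σ (e j))) / (Fintype.card (Equiv.Perm I) : ℝ) with hE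
  have hP : (0 : ℝ) < Fintype.card (Equiv.Perm I) := by exact_mod_cast Fintype.card_pos
  have hI : 0 < Fintype.card I := Fintype.card_pos
  have hI' : (0 : ℝ) < (Fintype.card I : ℝ) ^ Fintype.card J := by positivity
  have hE1 : E ≤ 1 := by
    rw [hE, div_le_one hP]
    calc _ ≤ ∑ σ : Equiv.Perm I, (1 : ℝ) := Finset.sum_le_sum (fun σ _ => h1 _)
      _ = _ := by simp
  have hE0 : 0 ≤ E := div_nonneg (Finset.sum_nonneg fun σ _ => h0 _) hP.le
  have hs := sum_emb_eq e F
  have hs2 : ∑ f : J ↪ I, F f = (Fintype.card (J ↪ I) : ℝ) * E := by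
    rw [hE, ← mul_div_assoc, ← hs]
    field_simp
  have hs3 : ∑ f : J ↪ I, F f ≤ ∑ f : J → I, F f := by
    have : ∑ f : J ↪ I, F f
        = ∑ f ∈ Finset.univ.image (fun f : J ↪ I => (f : J → I)), F f := by
      rw [Finset.sum_image]
      intro a _ b _ h
      exact DFunLike.coe_injective h
    rw [this]
    exact Finset.sum_le_sum_of_subset_of_nonneg (Finset.subset_univ _) (fun f _ _ => h0 f)
  have hc := desc_bound (Fintype.card I) (Fintype.card J) hI
  rw [← Fintype.card_embedding_eq] at hc
  have h4 : (Fintype.card (J ↪ I) : ℝ) / (Fintype.card I : ℝ) ^ Fintype.card J * E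
      ≤ (∑ f : J → I, F f) / (Fintype.card I : ℝ) ^ Fintype.card J := by
    rw [div_mul_eq_mul_div]
    gcongr
    linarith
  have h5 := mul_le_mul_of_nonneg_right hc hE0
  have h6 : (0 : ℝ) ≤ (Fintype.card J : ℝ) * (Fintype.card J - 1) / (2 * Fintype.card I) := by
    apply div_nonneg _ (by positivity)
    rcases Nat.eq_zero_or_pos (Fintype.card J) with h | h
    · simp [h]
    · have : (1 : ℝ) ≤ Fintype.card J := by exact_mod_cast h
      apply mul_nonneg <;> linarith
  nlinarith

/-- Sampling without replacement versus with replacement, lower bound. -/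
lemma le_perm_avg {I J : Type*} [Fintype I] [Fintype J] [DecidableEq I] [DecidableEq J] [Nonempty I] (e : J ↪ I)
    (F : (J → I) → ℝ) (h0 : ∀ f, 0 ≤ F f) (h1 : ∀ f, F f ≤ 1) :
    (∑ f : J → I, F f) / (Fintype.card I : ℝ) ^ Fintype.card J
        - (Fintype.card J : ℝ) * (Fintype.card J - 1) / (2 * Fintype.card I) ≤
    (∑ σ : Equiv.Perm I, F (fun j => σ (e j))) / (Fintype.card (Equiv.Perm I) : ℝ) := by
  have hP : (Fintype.card (Equiv.Perm I) : ℝ) ≠ 0 := by exact_mod_cast Fintype.card_ne_zero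
  have hI : (Fintype.card I : ℝ) ^ Fintype.card J ≠ 0 := by
    have : (Fintype.card I : ℝ) ≠ 0 := by exact_mod_cast Fintype.card_ne_zero
    positivity
  have h := perm_avg_le e (fun f => 1 - F f) (fun f => by linarith [h1 f])
    (fun f => by linarith [h0 f])
  have e1 : (∑ σ : Equiv.Perm I, (1 - F (fun j => σ (e j)))) / (Fintype.card (Equiv.Perm I) : ℝ)
      = 1 - (∑ σ : Equiv.Perm I, F (fun j => σ (e j))) / (Fintype.card (Equiv.Perm I) : ℝ) := by
    rw [Finset.sum_sub_distrib, sub_div, Finset.sum_const, Finset.card_univ, nsmul_eq_mul,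
      mul_one, div_self hP]
  have e2 : (∑ f : J → I, (1 - F f)) / (Fintype.card I : ℝ) ^ Fintype.card J
      = 1 - (∑ f : J → I, F f) / (Fintype.card I : ℝ) ^ Fintype.card J := by
    rw [Finset.sum_sub_distrib, sub_div, Finset.sum_const, Finset.card_univ, nsmul_eq_mul,
      mul_one, Fintype.card_fun]
    push_cast
    rw [div_self hI]
  rw [e1, e2] at h
  linarith

/-- Push forward of the uniform law on `J → I` along a string `s`. -/
lemma sum_comp_string {I J A : Type*} [Fintype I] [Fintype J] [DecidableEq I] [DecidableEq J] [Fintype A] (s : I → A)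
    (c : A → ℕ) (hc : ∀ a, (Finset.univ.filter (fun i => s i = a)).card = c a)
    (G : (J → A) → ℝ) :
    ∑ f : J → I, G (fun j => s (f j)) = ∑ y : J → A, G y * ∏ j, (c (y j) : ℝ) := by
  rw [← Finset.sum_fiberwise Finset.univ (fun f : J → I => (fun j => s (f j)))]
  refine Finset.sum_congr rfl fun y _ => ?_
  have h1 : ∀ f ∈ Finset.univ.filter (fun f : J → I => (fun j => s (f j)) = y),
      G (fun j => s (f j)) = G y := by
    intro f hf
    rw [(Finset.mem_filter.mp hf).2]
  rw [Finset.sum_congr rfl h1, Finset.sum_const, nsmul_eq_mul, mul_comm]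
  congr 1
  have h2 : Finset.univ.filter (fun f : J → I => (fun j => s (f j)) = y)
      = Fintype.piFinset (fun j => Finset.univ.filter (fun i => s i = y j)) := by
    ext f
    simp [funext_iff]
  rw [h2, Fintype.card_piFinset]
  push_cast
  simp [hc]

/-- A string of a given composition. -/
lemma exists_string {I A : Type*} [Fintype I] [Fintype A] (c : A → ℕ)
    (h : ∑ a, c a = Fintype.card I) :
    ∃ s : I → A, ∀ a, (Finset.univ.filter (fun i => s i = a)).card = c a := by
  have e : I ≃ (Σ a : A, Fin (c a)) := Fintype.equivOfCardEq (by simp [h])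
  refine ⟨fun i => (e i).1, fun a => ?_⟩
  rw [← Fintype.card_subtype]
  rw [Fintype.card_congr ((e.subtypeEquiv (p := fun i => (e i).1 = a)
    (q := fun x => x.1 = a) (fun _ => Iff.rfl)).trans (Equiv.sigmaSubtype a))]
  simp

/-- The empirical distribution of a list of `ℓ` blocks. -/
noncomputable def empW {Y : Type*} [DecidableEq Y] (ℓ : ℕ) (blk : Fin ℓ → Y) (y : Y) : ℝ :=
  (∑ b, if blk b = y then (1 : ℝ) else 0) / ℓ

lemma empW_sum {Y : Type*} [Fintype Y] [DecidableEq Y] (ℓ : ℕ) (blk : Fin ℓ → Y) (G : Y → ℝ) :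
    ∑ y, empW ℓ blk y * G y = (∑ b, G (blk b)) / ℓ := by
  simp only [empW, div_mul_eq_mul_div, Finset.sum_mul]
  rw [← Finset.sum_div, Finset.sum_comm]
  simp

lemma empW_sq {Y : Type*} [Fintype Y] [DecidableEq Y] (ℓ : ℕ) (blk : Fin ℓ → Y) (P : Y → ℝ) :
    ∑ y, (empW ℓ blk y - P y) ^ 2
      = (∑ b, ∑ c, if blk c = blk b then (1 : ℝ) else 0) / ℓ / ℓ
        - 2 * ((∑ b, P (blk b)) / ℓ) + ∑ y, P y * P y := by
  rw [← empW_sum ℓ blk P, Finset.mul_sum]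
  have : (∑ b, ∑ c, if blk c = blk b then (1 : ℝ) else 0) / ℓ / ℓ
      = ∑ y, empW ℓ blk y * empW ℓ blk y := by
    rw [empW_sum]
    simp only [empW]
    rw [← Finset.sum_div]
  rw [this, ← Finset.sum_sub_distrib, ← Finset.sum_add_distrib]
  exact Finset.sum_congr rfl fun y _ => by ring

/-- The second moment argument. -/
lemma exists_perm_good {A : Type*} [Fintype A] (k ℓ : ℕ) (hk : 1 ≤ k) (hkl : k < ℓ)
    (s : Fin ℓ × Fin k → A) (c : A → ℕ)
    (hc : ∀ a, (Finset.univ.filter (fun i => s i = a)).card = c a)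
    (Q : A → ℝ) (hQ0 : ∀ a, 0 ≤ Q a) (hQ1 : (∑ a, Q a) = 1)
    (hQc : ∀ a, Q a = (c a : ℝ) / (k * ℓ)) :
    ∃ σ : Equiv.Perm (Fin ℓ × Fin k),
      ∑ y : Fin k → A, (empW ℓ (fun b => fun j => s (σ (b, j))) y - ∏ i, Q (y i)) ^ 2
        ≤ 1 / ℓ + 3 * k / ℓ := by
  have hk0 : (0 : ℝ) < k := by exact_mod_cast hk
  have hl0 : (0 : ℝ) < ℓ := by exact_mod_cast (by omega : 0 < ℓ)
  have : Nonempty (Fin ℓ × Fin k) := ⟨(⟨0, by omega⟩, ⟨0, by omega⟩)⟩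
  set P : (Fin k → A) → ℝ := fun y => ∏ i, Q (y i) with hP
  set q : ℝ := ∑ y, P y * P y with hq
  have hQle : ∀ a, Q a ≤ 1 := fun a => by
    rw [← hQ1]
    exact Finset.single_le_sum (fun a _ => hQ0 a) (Finset.mem_univ a)
  have hP0 : ∀ y, 0 ≤ P y := fun y => Finset.prod_nonneg fun i _ => hQ0 _
  have hP1 : ∀ y, P y ≤ 1 := fun y => Finset.prod_le_one (fun i _ => hQ0 _) fun i _ => hQle _
  have hcQ : ∀ a, (c a : ℝ) = (k * ℓ) * Q a := fun a => by
    rw [hQc]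
    field_simp
  have hcP : ∀ y : Fin k → A, ∏ j, (c (y j) : ℝ) = ((k : ℝ) * ℓ) ^ k * P y := fun y => by
    simp only [hcQ, hP]
    rw [Finset.prod_mul_distrib, Finset.prod_const, Finset.card_univ, Fintype.card_fin]
  have hcard : (Fintype.card (Fin ℓ × Fin k) : ℝ) = k * ℓ := by
    simp [mul_comm]
  have hN : (k : ℝ) * ℓ ≠ 0 := by positivity
  set N : ℝ := (Fintype.card (Equiv.Perm (Fin ℓ × Fin k)) : ℝ) with hNdef
  have hN0 : 0 < N := by
    rw [hNdef]
    exact_mod_cast Fintype.card_pos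
  -- first moments
  have h1 : ∀ b : Fin ℓ, q - k / (2 * ℓ) ≤
      (∑ σ : Equiv.Perm (Fin ℓ × Fin k), P (fun j => s (σ (b, j)))) / N := by
    intro b
    have h := le_perm_avg (⟨fun j => (b, j), fun i j h => (Prod.mk.inj h).2⟩ : Fin k ↪ Fin ℓ × Fin k)
      (fun f => P (fun j => s (f j))) (fun f => hP0 _) (fun f => hP1 _)
    rw [sum_comp_string s c hc P, hcard] at h
    refine le_trans ?_ h
    simp only [hcP, Fintype.card_fin]
    have e1 : (∑ y, P y * (((k : ℝ) * ℓ) ^ k * P y)) / ((k : ℝ) * ℓ) ^ k = q := by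
      rw [hq, Finset.sum_div]
      refine Finset.sum_congr rfl fun y _ => ?_
      field_simp
    rw [e1]
    have : (k : ℝ) * (k - 1) / (2 * (k * ℓ)) ≤ k / (2 * ℓ) := by
      rw [div_le_div_iff₀ (by positivity) (by positivity)]
      nlinarith [mul_pos hk0 hl0]
    linarith
  -- second moments
  have h2 : ∀ b c' : Fin ℓ, b ≠ c' →
      (∑ σ : Equiv.Perm (Fin ℓ × Fin k),
        if (fun j => s (σ (c', j))) = (fun j => s (σ (b, j))) then (1 : ℝ) else 0) / N
        ≤ q + 2 * k / ℓ := by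
    intro b c' hbc
    have h := perm_avg_le (⟨fun j => Sum.elim (fun i => (b, i)) (fun i => (c', i)) j, by
        rintro (i | i) (j | j) h
        · simpa using h
        · exact absurd (Prod.mk.inj h).1 hbc
        · exact absurd (Prod.mk.inj h).1.symm hbc
        · simpa using h⟩ : Fin k ⊕ Fin k ↪ Fin ℓ × Fin k)
      (fun f => (fun y : Fin k ⊕ Fin k → A =>
        if (fun j => y (Sum.inr j)) = (fun j => y (Sum.inl j)) then (1 : ℝ) else 0)
          (fun j => s (f j))) (fun f => by dsimp only; split_ifs <;> norm_num)
          (fun f => by dsimp only; split_ifs <;> norm_num)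
    rw [sum_comp_string s c hc (fun y : Fin k ⊕ Fin k → A =>
        if (fun j => y (Sum.inr j)) = (fun j => y (Sum.inl j)) then (1 : ℝ) else 0), hcard] at h
    refine le_trans h ?_
    have e1 : (∑ y : Fin k ⊕ Fin k → A,
        (if (fun j => y (Sum.inr j)) = (fun j => y (Sum.inl j)) then (1 : ℝ) else 0)
          * ∏ j, (c (y j) : ℝ)) = ((k : ℝ) * ℓ) ^ (k + k) * q := by
      rw [Fintype.sum_equiv (Equiv.sumArrowEquivProdArrow (Fin k) (Fin k) A) _
        (fun p => (if p.2 = p.1 then (1 : ℝ) else 0)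
          * ((∏ j, (c (p.1 j) : ℝ)) * ∏ j, (c (p.2 j) : ℝ)))
        (fun y => by
          rw [Fintype.prod_sum_type]
          rfl)]
      rw [Fintype.sum_prod_type]
      simp only [hcP, ite_mul, zero_mul, one_mul, Finset.sum_ite_eq', Finset.mem_univ, if_true]
      rw [hq, Finset.mul_sum]
      refine Finset.sum_congr rfl fun y _ => ?_
      ring
    rw [e1]
    simp only [Fintype.card_sum, Fintype.card_fin]
    rw [mul_div_cancel_left₀ _ (pow_ne_zero _ hN)]
    have : ((k + k : ℕ) : ℝ) * ((k + k : ℕ) - 1) / (2 * (k * ℓ)) ≤ 2 * k / ℓ := by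
      rw [div_le_div_iff₀ (by positivity) (by positivity)]
      push_cast
      nlinarith [mul_pos hk0 hl0]
    linarith
  have hq0 : 0 ≤ q := Finset.sum_nonneg fun y _ => mul_nonneg (hP0 y) (hP0 y)
  -- averaged second moments, including the diagonal
  have h3 : ∀ b c' : Fin ℓ,
      (∑ σ : Equiv.Perm (Fin ℓ × Fin k),
        if (fun j => s (σ (c', j))) = (fun j => s (σ (b, j))) then (1 : ℝ) else 0) / N
        ≤ (q + 2 * k / ℓ) + if b = c' then 1 else 0 := by
    intro b c'
    by_cases h : b = c'
    · subst h
      simp only [if_true, Finset.sum_const, Finset.card_univ, nsmul_eq_mul, mul_one]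
      rw [← hNdef, div_self hN0.ne']
      have : (0 : ℝ) ≤ 2 * k / ℓ := by positivity
      linarith
    · simp only [h, if_false, add_zero]
      exact h2 b c' h
  have hmain : (∑ σ : Equiv.Perm (Fin ℓ × Fin k),
      ∑ y : Fin k → A, (empW ℓ (fun b => fun j => s (σ (b, j))) y - P y) ^ 2) / N
        ≤ 1 / ℓ + 3 * k / ℓ := by
    simp only [empW_sq]
    rw [Finset.sum_add_distrib, Finset.sum_sub_distrib, ← Finset.sum_div, ← Finset.sum_div,
      ← Finset.mul_sum, ← Finset.sum_div, add_div, sub_div, Finset.sum_const, Finset.card_univ,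
      nsmul_eq_mul, ← hNdef, mul_div_cancel_left₀ _ hN0.ne']
    have a1 : (∑ σ : Equiv.Perm (Fin ℓ × Fin k), ∑ b, ∑ c' : Fin ℓ,
        if (fun j => s (σ (c', j))) = (fun j => s (σ (b, j))) then (1 : ℝ) else 0) / N
          ≤ ℓ * ℓ * (q + 2 * k / ℓ) + ℓ := by
      calc _ = ∑ b : Fin ℓ, ∑ c' : Fin ℓ, (∑ σ : Equiv.Perm (Fin ℓ × Fin k),
        if (fun j => s (σ (c', j))) = (fun j => s (σ (b, j))) then (1 : ℝ) else 0) / N := by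
            rw [Finset.sum_comm, Finset.sum_div]
            refine Finset.sum_congr rfl fun b _ => ?_
            rw [Finset.sum_comm, Finset.sum_div]
        _ ≤ ∑ b : Fin ℓ, ∑ c' : Fin ℓ, ((q + 2 * k / ℓ) + if b = c' then 1 else 0) :=
            Finset.sum_le_sum fun b _ => Finset.sum_le_sum fun c' _ => h3 b c'
        _ = _ := by
            simp [Finset.sum_add_distrib]
            ring
    have a2 : ℓ * (q - k / (2 * ℓ)) ≤ (∑ σ : Equiv.Perm (Fin ℓ × Fin k), ∑ b : Fin ℓ,
        P (fun j => s (σ (b, j)))) / N := by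
      calc (ℓ : ℝ) * (q - k / (2 * ℓ)) = ∑ b : Fin ℓ, (q - k / (2 * ℓ)) := by
            rw [Finset.sum_const, Finset.card_univ, Fintype.card_fin, nsmul_eq_mul]
        _ ≤ ∑ b : Fin ℓ, (∑ σ : Equiv.Perm (Fin ℓ × Fin k), P (fun j => s (σ (b, j)))) / N :=
            Finset.sum_le_sum fun b _ => h1 b
        _ = _ := by
            rw [Finset.sum_comm, Finset.sum_div]
    rw [← hq]
    set X := (∑ σ : Equiv.Perm (Fin ℓ × Fin k), ∑ b, ∑ c' : Fin ℓ,
        if (fun j => s (σ (c', j))) = (fun j => s (σ (b, j))) then (1 : ℝ) else 0)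
    set Z := (∑ σ : Equiv.Perm (Fin ℓ × Fin k), ∑ b : Fin ℓ, P (fun j => s (σ (b, j))))
    have b1 : X / ℓ / ℓ / N ≤ q + 2 * k / ℓ + 1 / ℓ := by
      calc X / ℓ / ℓ / N = X / N / ℓ / ℓ := by ring
        _ ≤ (ℓ * ℓ * (q + 2 * k / ℓ) + ℓ) / ℓ / ℓ := by gcongr
        _ = _ := by field_simp
    have b2 : q - k / (2 * ℓ) ≤ Z / ℓ / N := by
      calc q - k / (2 * ℓ) = ℓ * (q - k / (2 * ℓ)) / ℓ := by field_simp
        _ ≤ Z / N / ℓ := by gcongr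
        _ = _ := by ring
    have b3 : 2 * (Z / ℓ) / N = 2 * (Z / ℓ / N) := by ring
    have b4 : (1 : ℝ) / ℓ + 3 * k / ℓ = (2 * k / ℓ + 1 / ℓ) + 2 * (k / (2 * ℓ)) := by
      field_simp
      ring
    rw [b3, b4]
    linarith
  by_contra hcon
  push Not at hcon
  rw [div_le_iff₀ hN0] at hmain
  have := Finset.sum_lt_sum_of_nonempty (Finset.univ_nonempty) (fun σ _ => hcon σ)
  rw [Finset.sum_const, Finset.card_univ, nsmul_eq_mul, ← hNdef] at this
  linarith

/-- Lemma 1, first part: for an `n`-type `Q` with `n = kℓ`, `ℓ > k ≥ 1`,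
there is an `ℓ`-type `W` on `A^k` lying in `E_k(Q)` with
`max_{a_1^k} |W(a_1^k) − Q^k(a_1^k)| ≤ M := [2/ℓ + 4k/ℓ + 2√(k/ℓ)]^{1/2}`. -/
theorem exists_ell_type_near_product {A : Type*} [Fintype A]
    (k ℓ : ℕ) (hk : 1 ≤ k) (hkl : k < ℓ)
    (Q : A → ℝ) (hQ0 : ∀ a, 0 ≤ Q a) (hQ1 : (∑ a, Q a) = 1)
    (hQtype : ∀ a, ∃ j : ℕ, Q a = (j : ℝ) / (k * ℓ)) :
    ∃ W : (Fin k → A) → ℝ,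
      (∀ y, 0 ≤ W y) ∧ (∑ y, W y) = 1 ∧
      (∀ y, ∃ j : ℕ, W y = (j : ℝ) / ℓ) ∧
      (∀ a : A, (∑ j : Fin k, marginal k W j a) / k = Q a) ∧
      (∀ y : Fin k → A, |W y - ∏ i, Q (y i)| ≤
        Real.sqrt (2 / ℓ + 4 * k / ℓ + 2 * Real.sqrt (k / ℓ))) := by
  have hk0 : (0 : ℝ) < k := by exact_mod_cast hk
  have hl0 : (0 : ℝ) < ℓ := by exact_mod_cast (by omega : 0 < ℓ)
  choose c hQc using hQtype
  have hsum : ∑ a, c a = Fintype.card (Fin ℓ × Fin k) := by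
    have h : ((∑ a, c a : ℕ) : ℝ) = k * ℓ := by
      simp only [hQc] at hQ1
      rw [← Finset.sum_div, div_eq_one_iff_eq (by positivity)] at hQ1
      push_cast
      exact hQ1
    have h' : ∑ a, c a = k * ℓ := by exact_mod_cast h
    rw [h']
    simp [mul_comm]
  obtain ⟨s, hs⟩ := exists_string c hsum
  obtain ⟨σ, hσ⟩ := exists_perm_good k ℓ hk hkl s c hs Q hQ0 hQ1 hQc
  refine ⟨empW ℓ (fun b => fun j => s (σ (b, j))), ?_, ?_, ?_, ?_, ?_⟩
  · intro y
    exact div_nonneg (Finset.sum_nonneg fun b _ => by split_ifs <;> norm_num) hl0.le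
  · have h := empW_sum ℓ (fun b => fun j => s (σ (b, j))) (fun _ => 1)
    simp only [mul_one] at h
    rw [h]
    simp [hl0.ne']
  · intro y
    refine ⟨(Finset.univ.filter (fun b : Fin ℓ => (fun j => s (σ (b, j))) = y)).card, ?_⟩
    rw [empW, Finset.sum_boole]
  · intro a
    have hm : ∀ j, marginal k (empW ℓ (fun b => fun j => s (σ (b, j)))) j a
        = (∑ b : Fin ℓ, if s (σ (b, j)) = a then (1 : ℝ) else 0) / ℓ := by
      intro j
      rw [← empW_sum ℓ (fun b => fun j => s (σ (b, j))) (fun y => if y j = a then (1 : ℝ) else 0)]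
      simp [marginal]
    simp only [hm]
    rw [← Finset.sum_div, Finset.sum_comm, ← Fintype.sum_prod_type'
      (f := fun (b : Fin ℓ) (j : Fin k) => if s (σ (b, j)) = a then (1 : ℝ) else 0)]
    have : (∑ x : Fin ℓ × Fin k, if s (σ (x.1, x.2)) = a then (1 : ℝ) else 0) = c a := by
      rw [Fintype.sum_equiv σ _ (fun x => if s x = a then (1 : ℝ) else 0) (fun x => rfl),
        Finset.sum_boole, hs]
    rw [this, hQc]
    field_simp
  · intro y
    apply Real.abs_le_sqrt
    have h1 := Finset.single_le_sum
      (f := fun y => (empW ℓ (fun b => fun j => s (σ (b, j))) y - ∏ i, Q (y i)) ^ 2)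
      (fun y _ => sq_nonneg _) (Finset.mem_univ y)
    refine le_trans h1 (le_trans hσ ?_)
    have h2 : (0 : ℝ) ≤ 2 * Real.sqrt (k / ℓ) := by positivity
    have h3 : (1 : ℝ) / ℓ ≤ 2 / ℓ := by gcongr; norm_num
    have h4 : (3 : ℝ) * k / ℓ ≤ 4 * k / ℓ := by gcongr; norm_num
    linarith
end

section
/- Under the hypotheses of the finite de Finetti theorem (n = kℓ, 2 ≤ k ≤ √ℓ/10), for any n-type Q on A: E[D(P̂_{Z_1^ℓ} ‖ Q^k) | P̂_{Z_1^ℓ} ∈ E_k(Q)] ≤ 2δ + (ℓ+1)^{2m^k} e^{−ℓδ} · k log n, where Z_1,...,Z_ℓ are i.i.d. uniform on A^k, E_k(Q) is the set of PMFs on A^k whose one-dimensional marginals average to Q, and δ is as in the theorem. -/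
open scoped Classical BigOperators

/-- The empirical PMF on `B` of a string `z ∈ B^ℓ`. -/
noncomputable def empPMF {B : Type*} [Fintype B] (ℓ : ℕ) (z : Fin ℓ → B) (w : B) : ℝ :=
  ((Finset.univ.filter (fun t : Fin ℓ => z t = w)).card : ℝ) / ℓ

/-- Relative entropy (natural log), finite-sum form. -/
noncomputable def relEnt {B : Type*} [Fintype B] (P Q : B → ℝ) : ℝ :=
  ∑ b, P b * Real.log (P b / Q b)

lemma aux_emp_sum {B : Type*} [Fintype B] (ℓ : ℕ) (z : Fin ℓ → B) (f : B → ℝ) :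
    ∑ w, empPMF ℓ z w * f w = (∑ t, f (z t)) / ℓ := by
  have h : ∀ w, empPMF ℓ z w * f w = (∑ t, if z t = w then f w else 0) / ℓ := by
    intro w
    unfold empPMF
    rw [← Finset.sum_filter, Finset.sum_const, nsmul_eq_mul]
    ring
  simp_rw [h]
  rw [← Finset.sum_div, Finset.sum_comm]
  simp

lemma aux_marg {A : Type*} [Fintype A] (k ℓ : ℕ) (z : Fin ℓ → (Fin k → A)) (a : A) :
    ∑ j : Fin k, marginal k (empPMF ℓ z) j a =
      ((Finset.univ.filter (fun p : Fin ℓ × Fin k => z p.1 p.2 = a)).card : ℝ) / ℓ := by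
  have h : ∀ j, marginal k (empPMF ℓ z) j a = (∑ t, if z t j = a then (1:ℝ) else 0) / ℓ := by
    intro j
    rw [← aux_emp_sum ℓ z (fun y => if y j = a then (1:ℝ) else 0)]
    unfold marginal
    simp
  simp_rw [h]
  rw [← Finset.sum_div, Finset.sum_comm, Finset.card_filter, Fintype.sum_prod_type]
  push_cast
  rfl

lemma aux_emp_pos {B : Type*} [Fintype B] (ℓ : ℕ) (z : Fin ℓ → B) (t : Fin ℓ) :
    0 < empPMF ℓ z (z t) := by
  unfold empPMF
  have h1 : 0 < (Finset.univ.filter (fun s : Fin ℓ => z s = z t)).card :=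
    Finset.card_pos.2 ⟨t, by simp⟩
  have h2 : 0 < ℓ := t.pos
  positivity

lemma aux_emp_le {B : Type*} [Fintype B] (ℓ : ℕ) (z : Fin ℓ → B) (w : B) :
    empPMF ℓ z w ≤ 1 := by
  unfold empPMF
  apply div_le_one_of_le₀ _ (by positivity)
  have := Finset.card_le_univ (Finset.univ.filter (fun s : Fin ℓ => z s = w))
  simp only [Fintype.card_fin] at this
  exact_mod_cast this

lemma aux_types {B : Type*} [Fintype B] (ℓ : ℕ) (hℓ : 0 < ℓ) :
    ∑ z : Fin ℓ → B, ∏ t, empPMF ℓ z (z t) ≤ (ℓ + 1 : ℝ) ^ (Fintype.card B) := by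
  let c : (Fin ℓ → B) → (B → Fin (ℓ + 1)) := fun z w =>
    ⟨(Finset.univ.filter (fun t : Fin ℓ => z t = w)).card, by
      have := Finset.card_le_univ (Finset.univ.filter (fun s : Fin ℓ => z s = w))
      simp only [Fintype.card_fin] at this
      omega⟩
  rw [← Finset.sum_fiberwise Finset.univ c]
  have key : ∀ κ : B → Fin (ℓ + 1),
      ∑ z ∈ Finset.univ.filter (fun z => c z = κ), ∏ t, empPMF ℓ z (z t) ≤ 1 := by
    intro κ
    rcases (Finset.univ.filter (fun z => c z = κ)).eq_empty_or_nonempty with h | ⟨z0, h0⟩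
    · rw [h]; simp
    · have hz : ∀ z ∈ Finset.univ.filter (fun z => c z = κ), empPMF ℓ z = empPMF ℓ z0 := by
        intro z hz
        simp only [Finset.mem_filter, Finset.mem_univ, true_and] at hz h0
        have h1 : c z = c z0 := hz.trans h0.symm
        funext w
        have h2 := congrArg Fin.val (congrFun h1 w)
        simp only [c] at h2
        unfold empPMF
        rw [h2]
      calc _ = ∑ z ∈ Finset.univ.filter (fun z => c z = κ), ∏ t, empPMF ℓ z0 (z t) :=
            Finset.sum_congr rfl (fun z hz' => by rw [hz z hz'])
        _ ≤ ∑ z : Fin ℓ → B, ∏ t, empPMF ℓ z0 (z t) := by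
            apply Finset.sum_le_sum_of_subset_of_nonneg (Finset.filter_subset _ _)
            intro z _ _
            exact Finset.prod_nonneg (fun t _ => by unfold empPMF; positivity)
        _ = (∑ w, empPMF ℓ z0 w) ^ ℓ := (Fintype.sum_pow _ _).symm
        _ = 1 := by
            have := aux_emp_sum ℓ z0 (fun _ => 1)
            simp only [mul_one] at this
            rw [this]
            have : (ℓ : ℝ) ≠ 0 := by positivity
            simp [this]
  calc _ ≤ ∑ κ : B → Fin (ℓ + 1), (1 : ℝ) := Finset.sum_le_sum (fun κ _ => key κ)
    _ = _ := by simp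

lemma aux_fact (n c : ℕ) (hn : 0 < n) (hc : c ≤ n) :
    (c.factorial : ℝ) * Real.exp c ≤ (Real.exp 1 * n) * (c : ℝ) ^ c := by
  rcases Nat.eq_zero_or_pos c with rfl | hpos
  · have : (1 : ℝ) ≤ n := by exact_mod_cast hn
    have h2 := Real.add_one_le_exp (1 : ℝ)
    simp
    nlinarith
  have main : (c.factorial : ℝ) * Real.exp c ≤ (Real.exp 1 * c) * (c : ℝ) ^ c := by
    clear hc
    induction c, hpos using Nat.le_induction with
    | base => simp
    | succ c hc ih =>
      have hc' : (0 : ℝ) < c := by exact_mod_cast hc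
      have h1 : Real.exp 1 * (c : ℝ) ^ (c + 1) ≤ ((c + 1 : ℕ) : ℝ) ^ (c + 1) := by
        have h := Real.one_sub_inv_le_log_of_pos (x := ((c : ℝ) + 1) / c) (by positivity)
        have h3 : (1 : ℝ) ≤ (c + 1) * Real.log (((c : ℝ) + 1) / c) := by
          have : (1 : ℝ) = (c + 1) * (1 - (((c : ℝ) + 1) / c)⁻¹) := by field_simp; ring
          calc (1 : ℝ) = (c + 1) * (1 - (((c : ℝ) + 1) / c)⁻¹) := this
            _ ≤ _ := mul_le_mul_of_nonneg_left h (by positivity)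
        have h4 : Real.exp 1 ≤ (((c : ℝ) + 1) / c) ^ (c + 1) := by
          rw [← Real.exp_log (x := (((c : ℝ) + 1) / c) ^ (c + 1)) (by positivity)]
          apply Real.exp_le_exp.2
          rw [Real.log_pow]; push_cast; exact h3
        calc _ ≤ (((c : ℝ) + 1) / c) ^ (c + 1) * (c : ℝ) ^ (c + 1) := by gcongr
          _ = _ := by rw [← mul_pow]; congr 1; push_cast; field_simp
      rw [Nat.factorial_succ]
      push_cast at *
      rw [Real.exp_add]
      calc ((c : ℝ) + 1) * c.factorial * (Real.exp c * Real.exp 1)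
          = (c + 1) * Real.exp 1 * (c.factorial * Real.exp c) := by ring
        _ ≤ (c + 1) * Real.exp 1 * (Real.exp 1 * c * c ^ c) := by gcongr
        _ = Real.exp 1 * (c + 1) * (Real.exp 1 * c ^ (c + 1)) := by ring
        _ ≤ _ := by gcongr
  refine main.trans ?_
  gcongr

lemma aux_count {A S : Type*} [Fintype A] [Fintype S] (c : A → ℕ)
    (hc : ∑ a, c a = Fintype.card S) :
    (Fintype.card S).factorial ≤
      (Finset.univ.filter (fun x : S → A =>
        ∀ a, (Finset.univ.filter (fun s => x s = a)).card = c a)).card * ∏ a, (c a).factorial := by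
  have e : S ≃ Σ a, Fin (c a) := Fintype.equivOfCardEq (by simp [hc])
  let f : S → A := fun s => (e s).1
  have hfc : ∀ a, Fintype.card {s // f s = a} = c a := by
    intro a
    have e1 : {s // f s = a} ≃ {s : Σ a, Fin (c a) // s.1 = a} := e.subtypeEquiv (fun s => Iff.rfl)
    rw [Fintype.card_congr (e1.trans (Equiv.sigmaSubtype a))]
    simp
  have h1 := DomMulAct.stabilizer_card f
  have : Fintype (Equiv.Perm S)ᵈᵐᵃ := Fintype.ofEquiv _ DomMulAct.mk
  have h2 := MulAction.card_orbit_mul_card_stabilizer_eq_card_group (Equiv.Perm S)ᵈᵐᵃ f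
  rw [← Nat.card_eq_fintype_card, ← Nat.card_eq_fintype_card, ← Nat.card_eq_fintype_card] at h2
  rw [← Nat.card_eq_fintype_card] at h1
  have h3 : Nat.card (Equiv.Perm S)ᵈᵐᵃ = (Fintype.card S).factorial := by
    rw [Nat.card_congr DomMulAct.mk.symm, Nat.card_eq_fintype_card, Fintype.card_perm]
  have h4 : Nat.card (MulAction.stabilizer (Equiv.Perm S)ᵈᵐᵃ f) =
      Nat.card {g : Equiv.Perm S // f ∘ g = f} :=
    Nat.card_congr (Equiv.subtypeEquiv DomMulAct.mk (fun _ => Iff.rfl)).symm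
  rw [← h3, ← h2, h4, h1]
  simp_rw [hfc]
  apply Nat.mul_le_mul_right
  rw [Nat.card_eq_fintype_card, ← Set.toFinset_card]
  apply Finset.card_le_card
  intro x hx
  simp only [Set.mem_toFinset] at hx
  obtain ⟨g, rfl⟩ := hx
  simp only [Finset.mem_filter, Finset.mem_univ, true_and]
  intro a
  rw [← hfc a, ← Fintype.card_subtype]
  apply Fintype.card_congr
  exact (DomMulAct.mk.symm g).subtypeEquiv (fun s => Iff.rfl)

lemma aux_dom {A S : Type*} [Fintype A] [Fintype S] (c : A → ℕ)
    (hc : ∑ a, c a = Fintype.card S) (hS : 0 < Fintype.card S) :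
    1 ≤ ((Finset.univ.filter (fun x : S → A =>
        ∀ a, (Finset.univ.filter (fun s => x s = a)).card = c a)).card : ℝ) *
      (∏ a, ((c a : ℝ) / Fintype.card S) ^ c a) *
      (Real.exp 1 * Fintype.card S) ^ Fintype.card A := by
  have h := aux_count c hc
  set T := (Finset.univ.filter (fun x : S → A =>
        ∀ a, (Finset.univ.filter (fun s => x s = a)).card = c a)).card
  set n := Fintype.card S
  have hn : (0 : ℝ) < n := by exact_mod_cast hS
  have h' : (n.factorial : ℝ) ≤ T * ∏ a, ((c a).factorial : ℝ) := by exact_mod_cast h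
  have h1 : (n : ℝ) ^ n ≤ n.factorial * Real.exp n := by
    have := Real.pow_div_factorial_le_exp (n : ℝ) hn.le n
    rw [div_le_iff₀ (by positivity)] at this
    linarith
  have h2 : (∏ a, ((c a).factorial : ℝ)) * Real.exp n ≤
      (Real.exp 1 * n) ^ Fintype.card A * ∏ a, (c a : ℝ) ^ c a := by
    have e1 : Real.exp n = ∏ a, Real.exp (c a) := by
      rw [← Real.exp_sum, ← hc]; push_cast; rfl
    rw [e1, ← Finset.prod_mul_distrib]
    calc _ ≤ ∏ a, ((Real.exp 1 * n) * (c a : ℝ) ^ c a) := by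
          apply Finset.prod_le_prod
          · intro a _; positivity
          · intro a _
            apply aux_fact n (c a) hS
            rw [← hc]
            exact Finset.single_le_sum (f := c) (fun _ _ => Nat.zero_le _) (Finset.mem_univ a)
      _ = _ := by rw [Finset.prod_mul_distrib, Finset.prod_const, Finset.card_univ]
  have h3 : (n : ℝ) ^ n ≤ T * ((Real.exp 1 * n) ^ Fintype.card A * ∏ a, (c a : ℝ) ^ c a) := by
    calc (n : ℝ) ^ n ≤ n.factorial * Real.exp n := h1
      _ ≤ (T * ∏ a, ((c a).factorial : ℝ)) * Real.exp n := by gcongr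
      _ = T * ((∏ a, ((c a).factorial : ℝ)) * Real.exp n) := by ring
      _ ≤ _ := by gcongr
  have e2 : ∏ a, ((c a : ℝ) / n) ^ c a = (∏ a, (c a : ℝ) ^ c a) / (n : ℝ) ^ n := by
    simp_rw [div_pow]
    rw [Finset.prod_div_distrib, Finset.prod_pow_eq_pow_sum, hc]
  rw [e2]
  have : (T : ℝ) * ((∏ a, (c a : ℝ) ^ c a) / (n : ℝ) ^ n) * (Real.exp 1 * n) ^ Fintype.card A
    = T * ((Real.exp 1 * n) ^ Fintype.card A * ∏ a, (c a : ℝ) ^ c a) / (n : ℝ) ^ n := by ring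
  rw [this, one_le_div (by positivity)]
  exact h3

lemma aux_delta (m k ℓ : ℕ) (hm : 1 ≤ m) (hk2 : 2 ≤ k) (hkℓ : (k : ℝ) ≤ Real.sqrt ℓ / 10)
    (α δ : ℝ)
    (hα : α = Real.sqrt (2 * k / Real.sqrt (k * ℓ) *
      ((1 + 2 * k) / Real.sqrt (k * ℓ) + 1)))
    (hδ : δ = α * Real.log ((m : ℝ) ^ k / α)) : 0 < δ := by
  have hk : (2 : ℝ) ≤ k := by exact_mod_cast hk2
  have hs : 10 * (k : ℝ) ≤ Real.sqrt ℓ := by linarith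
  have hr : 10 * (k : ℝ) ≤ Real.sqrt (k * ℓ) := by
    refine hs.trans (Real.sqrt_le_sqrt ?_)
    have : (0 : ℝ) ≤ ℓ := by positivity
    nlinarith
  set r := Real.sqrt (k * ℓ)
  have hrpos : 0 < r := by linarith
  have hαpos : 0 < α := by
    rw [hα]; apply Real.sqrt_pos.2; positivity
  have hα1 : α < 1 := by
    rw [hα, Real.sqrt_lt' one_pos]
    have h1 : 2 * (k : ℝ) / r ≤ 1 / 5 := by rw [div_le_div_iff₀ hrpos (by norm_num)]; linarith
    have h2 : (1 + 2 * (k : ℝ)) / r ≤ 1 := by rw [div_le_one hrpos]; linarith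
    have h3 : 0 ≤ 2 * (k : ℝ) / r := by positivity
    have h4 : 0 ≤ (1 + 2 * (k : ℝ)) / r := by positivity
    nlinarith
  rw [hδ]
  apply mul_pos hαpos
  apply Real.log_pos
  rw [one_lt_div hαpos]
  have : (1 : ℝ) ≤ (m : ℝ) ^ k := one_le_pow₀ (by exact_mod_cast hm)
  linarith

/-- Core: relative entropy times `ℓ` for strings of exact type. -/
lemma aux_relEnt {B : Type*} [Fintype B] (ℓ : ℕ) (hℓ : 0 < ℓ) (z : Fin ℓ → B) (R : B → ℝ)
    (hR : ∀ t, 0 < R (z t)) :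
    (∏ t, R (z t)) * Real.exp (ℓ * relEnt (empPMF ℓ z) R) = ∏ t, empPMF ℓ z (z t) := by
  unfold relEnt
  have hl : (ℓ : ℝ) ≠ 0 := by positivity
  rw [aux_emp_sum ℓ z (fun b => Real.log (empPMF ℓ z b / R b)), mul_div_cancel₀ _ hl,
    Real.exp_sum, ← Finset.prod_mul_distrib]
  apply Finset.prod_congr rfl
  intro t _
  rw [Real.exp_log (div_pos (aux_emp_pos ℓ z t) (hR t))]
  have := (hR t).ne'
  field_simp

lemma aux_R (m k ℓ : ℕ) (hm : 2 ≤ m) (hk2 : 2 ≤ k) (hkℓ : (k : ℝ) ≤ Real.sqrt ℓ / 10) :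
    (Real.exp 1 * ((k * ℓ : ℕ) : ℝ)) ^ m ≤ (ℓ + 1 : ℝ) ^ (m ^ k) := by
  have hs : 10 * (k : ℝ) ≤ Real.sqrt ℓ := by linarith
  have hk : (2 : ℝ) ≤ k := by exact_mod_cast hk2
  have hsq : Real.sqrt ℓ ^ 2 = (ℓ : ℝ) := Real.sq_sqrt (by positivity)
  have h10 : 10 * (k : ℝ) ≤ ℓ := by nlinarith
  have he := Real.exp_one_lt_d9
  have h1 : Real.exp 1 * ((k * ℓ : ℕ) : ℝ) ≤ (ℓ + 1 : ℝ) ^ 2 := by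
    push_cast
    have : Real.exp 1 * k ≤ ℓ := by nlinarith
    nlinarith
  calc _ ≤ ((ℓ + 1 : ℝ) ^ 2) ^ m := by gcongr
    _ = (ℓ + 1 : ℝ) ^ (2 * m) := by rw [pow_mul]
    _ ≤ _ := by
      apply pow_le_pow_right₀
      · have : (0 : ℝ) ≤ ℓ := by positivity
        linarith
      · calc 2 * m ≤ m * m := by gcongr
          _ = m ^ 2 := by ring
          _ ≤ m ^ k := by gcongr; omega

lemma aux_main {A : Type*} [Fintype A]
    (k ℓ : ℕ) (hk2 : 2 ≤ k) (hkℓ : (k : ℝ) ≤ Real.sqrt ℓ / 10)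
    (Q : A → ℝ) (hQ1 : (∑ a, Q a) = 1)
    (c : A → ℕ) (hc : ∀ a, Q a = (c a : ℝ) / (k * ℓ))
    (δ : ℝ) (hδ : 0 < δ) (E : Finset (Fin ℓ → (Fin k → A)))
    (hE : ∀ z, z ∈ E ↔
      ∀ a, (Finset.univ.filter (fun p : Fin ℓ × Fin k => z p.1 p.2 = a)).card = c a) :
    (∑ z ∈ E, relEnt (empPMF ℓ z) (fun y : Fin k → A => ∏ i, Q (y i))) / (E.card : ℝ)
      ≤ 2 * δ + (ℓ + 1 : ℝ) ^ (2 * Fintype.card A ^ k) *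
          Real.exp (-(ℓ : ℝ) * δ) * (k * Real.log (k * ℓ)) := by
  have hk : (2 : ℝ) ≤ k := by exact_mod_cast hk2
  have hℓR : (1 : ℝ) ≤ ℓ := by
    have hsq : Real.sqrt ℓ ^ 2 = (ℓ : ℝ) := Real.sq_sqrt (by positivity)
    nlinarith
  have hℓ : 0 < ℓ := by exact_mod_cast (by linarith : (0 : ℝ) < ℓ)
  have hn1 : (1 : ℝ) ≤ k * ℓ := by nlinarith
  have hn : (0 : ℝ) < k * ℓ := by linarith
  have hcs : ∑ a, c a = k * ℓ := by
    have : ((∑ a, c a : ℕ) : ℝ) = k * ℓ := by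
      simp_rw [hc] at hQ1
      rw [← Finset.sum_div, div_eq_one_iff_eq hn.ne'] at hQ1
      push_cast; exact hQ1
    exact_mod_cast this
  set q : ℝ := ∏ a, Q a ^ c a with hq
  have hcard : Fintype.card (Fin ℓ × Fin k) = k * ℓ := by simp [mul_comm]
  -- positivity of `Q` along strings of the class
  have hQpos : ∀ z ∈ E, ∀ t i, 1 / ((k : ℝ) * ℓ) ≤ Q (z t i) := by
    intro z hz t i
    have h1 := (hE z).1 hz (z t i)
    have h2 : 0 < c (z t i) := by
      rw [← h1]
      exact Finset.card_pos.2 ⟨(t, i), by simp⟩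
    rw [hc]
    have : (1 : ℝ) ≤ c (z t i) := by exact_mod_cast h2
    gcongr
  have hQpos' : ∀ z ∈ E, ∀ t i, 0 < Q (z t i) := fun z hz t i =>
    lt_of_lt_of_le (by positivity) (hQpos z hz t i)
  have hqz : ∀ z ∈ E, ∏ t, ∏ i, Q (z t i) = q := by
    intro z hz
    rw [← Fintype.prod_prod_type (f := fun p : Fin ℓ × Fin k => Q (z p.1 p.2))]
    rw [← Finset.prod_fiberwise' Finset.univ (fun p : Fin ℓ × Fin k => z p.1 p.2) Q]
    apply Finset.prod_congr rfl
    intro a _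
    rw [Finset.prod_const, (hE z).1 hz a]
  set D : (Fin ℓ → (Fin k → A)) → ℝ := fun z =>
    relEnt (empPMF ℓ z) (fun y : Fin k → A => ∏ i, Q (y i)) with hD
  set p : (Fin ℓ → (Fin k → A)) → ℝ := fun z => ∏ t, empPMF ℓ z (z t) with hp
  have hp0 : ∀ z, 0 ≤ p z := fun z => Finset.prod_nonneg (fun t _ => (aux_emp_pos ℓ z t).le)
  have hp1 : ∀ z, p z ≤ 1 := fun z => Finset.prod_le_one
    (fun t _ => (aux_emp_pos ℓ z t).le) (fun t _ => aux_emp_le ℓ z _)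
  have hDz : ∀ z ∈ E, q * Real.exp (ℓ * D z) = p z := by
    intro z hz
    rw [← hqz z hz]
    exact aux_relEnt ℓ hℓ z (fun y : Fin k → A => ∏ i, Q (y i))
      (fun t => Finset.prod_pos (fun i _ => hQpos' z hz t i))
  have hlogn : 0 ≤ (k : ℝ) * Real.log (k * ℓ) :=
    mul_nonneg (by positivity) (Real.log_nonneg hn1)
  have hDmax : ∀ z ∈ E, D z ≤ k * Real.log (k * ℓ) := by
    intro z hz
    have h1 : (1 / ((k : ℝ) * ℓ)) ^ (k * ℓ) ≤ q := by
      rw [← hqz z hz]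
      calc (1 / ((k : ℝ) * ℓ)) ^ (k * ℓ) = ∏ t : Fin ℓ, ∏ i : Fin k, (1 / ((k : ℝ) * ℓ)) := by
            simp [pow_mul]
        _ ≤ _ := by
            apply Finset.prod_le_prod
            · intro t _; positivity
            · intro t _
              apply Finset.prod_le_prod
              · intro i _; positivity
              · intro i _; exact hQpos z hz t i
    have h2 : Real.exp (ℓ * D z) ≤ ((k : ℝ) * ℓ) ^ (k * ℓ) := by
      have h3 : (1 / ((k : ℝ) * ℓ)) ^ (k * ℓ) * Real.exp (ℓ * D z) ≤ 1 := by
        calc _ ≤ q * Real.exp (ℓ * D z) := by gcongr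
          _ = p z := hDz z hz
          _ ≤ 1 := hp1 z
      rw [one_div, inv_pow, inv_mul_le_iff₀ (by positivity), mul_one] at h3
      exact h3
    have h4 := Real.log_le_log (Real.exp_pos _) h2
    rw [Real.log_exp, Real.log_pow] at h4
    push_cast at h4
    have h5 : (ℓ : ℝ) * D z ≤ ℓ * (k * Real.log (k * ℓ)) := by linarith
    exact le_of_mul_le_mul_left h5 (by linarith)
  -- lower bound of the class size
  have hlow : 1 ≤ (E.card : ℝ) * q * (ℓ + 1 : ℝ) ^ (Fintype.card A ^ k) := by
    obtain ⟨T, hT, hdom⟩ : ∃ T : Finset (Fin ℓ × Fin k → A),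
        (∀ x, x ∈ T ↔ ∀ a, (Finset.univ.filter (fun s => x s = a)).card = c a) ∧
        1 ≤ (T.card : ℝ) * (∏ a, ((c a : ℝ) / Fintype.card (Fin ℓ × Fin k)) ^ c a) *
          (Real.exp 1 * Fintype.card (Fin ℓ × Fin k)) ^ Fintype.card A :=
      ⟨_, fun x => by rw [Finset.mem_filter]; exact and_iff_right (@Finset.mem_univ _ (_) x),
        aux_dom (S := Fin ℓ × Fin k) c (by rw [hcs, hcard]) (by rw [hcard]; positivity)⟩
    rw [hcard] at hdom
    have hEc : T.card = E.card := by
      apply Finset.card_bij (fun x _ => Function.curry x)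
      · intro x hx
        exact (hE _).2 ((hT x).1 hx)
      · intro x _ y _ h
        exact Function.curry_injective h
      · intro z hz
        exact ⟨Function.uncurry z, (hT _).2 ((hE z).1 hz), by simp⟩
    have hqe : ∏ a, ((c a : ℝ) / ((k * ℓ : ℕ) : ℝ)) ^ c a = q := by
      rw [hq]; apply Finset.prod_congr rfl; intro a _; rw [hc a]; push_cast; rfl
    rw [hEc, hqe] at hdom
    have hq0 : 0 ≤ q := by
      rw [← hqe]; positivity
    by_cases hm : 2 ≤ Fintype.card A
    · refine hdom.trans ?_
      gcongr
      exact aux_R _ k ℓ hm hk2 hkℓ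
    · have hEpos : (1 : ℝ) ≤ E.card := by
        rcases Nat.eq_zero_or_pos E.card with h | h
        · rw [h] at hdom; norm_num at hdom
        · exact_mod_cast h
      have hq1 : q = 1 := by
        rw [hq]
        apply Finset.prod_eq_one
        intro a _
        have hs : Subsingleton A := Fintype.card_le_one_iff_subsingleton.1 (by omega)
        have : ∑ b, Q b = Q a := Fintype.sum_eq_single a (fun b hb => absurd (Subsingleton.elim b a) hb)
        rw [← this, hQ1, one_pow]
      rw [hq1, mul_one]
      have : (1 : ℝ) ≤ (ℓ + 1 : ℝ) ^ (Fintype.card A ^ k) := one_le_pow₀ (by linarith)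
      nlinarith
  have hEq : 0 < (E.card : ℝ) * q := by
    by_contra hcon
    have : (0 : ℝ) < (ℓ + 1 : ℝ) ^ (Fintype.card A ^ k) := by positivity
    nlinarith
  have hE0 : (0 : ℝ) < E.card := by
    rcases Nat.eq_zero_or_pos E.card with h | h
    · rw [h] at hEq; norm_num at hEq
    · exact_mod_cast h
  have hq0 : 0 < q := by
    by_contra hcon
    nlinarith
  -- the bad set
  set Bad := E.filter (fun z => 2 * δ < D z) with hBad
  have hbad : (Bad.card : ℝ) * (q * Real.exp (ℓ * (2 * δ))) ≤
      (ℓ + 1 : ℝ) ^ (Fintype.card A ^ k) := by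
    calc (Bad.card : ℝ) * (q * Real.exp (ℓ * (2 * δ)))
        = ∑ z ∈ Bad, q * Real.exp (ℓ * (2 * δ)) := by rw [Finset.sum_const, nsmul_eq_mul]
      _ ≤ ∑ z ∈ Bad, p z := by
          apply Finset.sum_le_sum
          intro z hz
          rw [hBad, Finset.mem_filter] at hz
          rw [← hDz z hz.1]
          have := hz.2.le
          gcongr
      _ ≤ ∑ z, p z := Finset.sum_le_sum_of_subset_of_nonneg (Finset.subset_univ _)
          (fun z _ _ => hp0 z)
      _ ≤ _ := by
          have := aux_types (B := Fin k → A) ℓ hℓ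
          simpa using this
  set X : ℝ := (ℓ + 1 : ℝ) ^ (Fintype.card A ^ k) with hX
  have hX0 : 0 < X := by positivity
  have hXX : (ℓ + 1 : ℝ) ^ (2 * Fintype.card A ^ k) = X * X := by
    rw [hX, ← pow_add, two_mul]
  have hbad2 : (Bad.card : ℝ) ≤ E.card * (X * X * Real.exp (-(ℓ : ℝ) * δ)) := by
    have h1 : (Bad.card : ℝ) * q ≤ X * Real.exp (-(ℓ : ℝ) * δ) := by
      have h2 : Real.exp (ℓ * δ) ≤ Real.exp (ℓ * (2 * δ)) := by
        apply Real.exp_le_exp.2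
        have : 0 ≤ (ℓ : ℝ) * δ := by positivity
        linarith
      have h3 : (Bad.card : ℝ) * (q * Real.exp (ℓ * δ)) ≤ X := by
        refine le_trans ?_ hbad
        gcongr
      rw [neg_mul, Real.exp_neg, ← div_eq_mul_inv, le_div_iff₀ (Real.exp_pos _)]
      linarith
    have h4 : (Bad.card : ℝ) * q ≤ E.card * (X * X * Real.exp (-(ℓ : ℝ) * δ)) * q := by
      calc _ ≤ 1 * (X * Real.exp (-(ℓ : ℝ) * δ)) := by rw [one_mul]; exact h1
        _ ≤ (E.card * q * X) * (X * Real.exp (-(ℓ : ℝ) * δ)) := by gcongr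
        _ = _ := by ring
    exact le_of_mul_le_mul_right h4 hq0
  rw [div_le_iff₀ hE0, hXX]
  have hsum : ∑ z ∈ E, D z ≤ E.card * (2 * δ) + Bad.card * (k * Real.log (k * ℓ)) := by
    calc ∑ z ∈ E, D z ≤ ∑ z ∈ E, (2 * δ + if 2 * δ < D z then k * Real.log (k * ℓ) else 0) := by
          apply Finset.sum_le_sum
          intro z hz
          split_ifs with h
          · have := hDmax z hz; linarith
          · linarith
      _ = _ := by
          rw [Finset.sum_add_distrib, Finset.sum_const, nsmul_eq_mul, ← Finset.sum_filter,
            Finset.sum_const, nsmul_eq_mul]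
  calc ∑ z ∈ E, D z ≤ E.card * (2 * δ) + Bad.card * (k * Real.log (k * ℓ)) := hsum
    _ ≤ E.card * (2 * δ) + (E.card * (X * X * Real.exp (-(ℓ : ℝ) * δ))) *
        (k * Real.log (k * ℓ)) := by gcongr
    _ = _ := by ring

/-- Lemma 2: for `n = kℓ`, `2 ≤ k ≤ √ℓ/10`, and any `n`-type `Q`,
`E[D(P̂_{Z_1^ℓ}‖Q^k) | P̂_{Z_1^ℓ} ∈ E_k(Q)] ≤ 2δ + (ℓ+1)^{2m^k} e^{−ℓδ} k log n`,
where `Z_1,…,Z_ℓ` are i.i.d. uniform on `A^k`, `E_k(Q)` is the set of PMFs on `A^k`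
whose one-dimensional marginals average to `Q`, and
`δ = α log(m^k/α)` with `α = [2k/√n·((1+2k)/√n + 1)]^{1/2}`. -/
theorem conditional_expected_divergence_bound {A : Type*} [Fintype A]
    (k ℓ : ℕ) (hk2 : 2 ≤ k) (hkℓ : (k : ℝ) ≤ Real.sqrt ℓ / 10)
    (Q : A → ℝ) (hQ0 : ∀ a, 0 ≤ Q a) (hQ1 : (∑ a, Q a) = 1)
    (hQtype : ∀ a, ∃ j : ℕ, Q a = (j : ℝ) / (k * ℓ))
    (α δ : ℝ)
    (hα : α = Real.sqrt (2 * k / Real.sqrt (k * ℓ) *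
      ((1 + 2 * k) / Real.sqrt (k * ℓ) + 1)))
    (hδ : δ = α * Real.log ((Fintype.card A : ℝ) ^ k / α)) :
    (∑ z : Fin ℓ → (Fin k → A),
        if (∀ a : A, (∑ j : Fin k, marginal k (empPMF ℓ z) j a) / k = Q a)
        then relEnt (empPMF ℓ z) (fun y : Fin k → A => ∏ i, Q (y i)) else 0)
      / ((Finset.univ.filter (fun z : Fin ℓ → (Fin k → A) =>
          ∀ a : A, (∑ j : Fin k, marginal k (empPMF ℓ z) j a) / k = Q a)).card : ℝ)
      ≤ 2 * δ + (ℓ + 1 : ℝ) ^ (2 * Fintype.card A ^ k) *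
          Real.exp (-(ℓ : ℝ) * δ) * (k * Real.log (k * ℓ)) := by
  have hkpos : (0 : ℝ) < k := by
    have : (2 : ℝ) ≤ k := by exact_mod_cast hk2
    linarith
  choose c hc using hQtype
  have hm : 1 ≤ Fintype.card A := by
    rcases Nat.eq_zero_or_pos (Fintype.card A) with h | h
    · have : IsEmpty A := Fintype.card_eq_zero_iff.1 h
      simp at hQ1
    · exact h
  have hδ0 := aux_delta (Fintype.card A) k ℓ hm hk2 hkℓ α δ hα hδ
  have hℓpos : (0 : ℝ) < ℓ := by
    have hsq : Real.sqrt ℓ ^ 2 = (ℓ : ℝ) := Real.sq_sqrt (by positivity)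
    nlinarith
  rw [← Finset.sum_filter]
  apply aux_main k ℓ hk2 hkℓ Q hQ1 c hc δ hδ0
  intro z
  simp only [Finset.mem_filter, Finset.mem_univ, true_and]
  refine forall_congr' (fun a => ?_)
  rw [aux_marg, hc a, div_div, mul_comm (ℓ : ℝ) k, div_left_inj' (by positivity)]
  exact Nat.cast_inj
end
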